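/- arXiv:math/0508403 — 2 statements merged into one kernel-verified Lean document; each statement's English description precedes it below -/
import Mathlib

section
/- Let p be a prime with p ≡ 3 (mod 4) and let n be a natural number such that (1 − p²(p−1)/(p+1)⁴)ⁿ < 1/(2e). Then for every i ∈ F_p, the total variation distance between the distribution of the random walk after 4n steps started at i and π is at most 1/(2e): (1/2)·∑_{j ∈ F_p} |(A^{4n})(i,j) − π(j)| ≤ 1/(2e). -/
open Finset

/-- The circle of quadrance `K` centered at the origin in `F_p × F_p`. -/
def circ (p : ℕ) [NeZero p] (K : ZMod p) : Finset (ZMod p × ZMod p) :=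
  Finset.univ.filter (fun v => v.1 ^ 2 + v.2 ^ 2 = K)

/-- `N_{ij}^k`: the number of pairs `(a, b)` with `a ∈ C_i`, `b ∈ C_j`, `a + b ∈ C_k`. -/
def Ncirc (p : ℕ) [NeZero p] (i j k : ZMod p) : ℕ :=
  ((circ p i ×ˢ circ p j).filter (fun ab => ab.1 + ab.2 ∈ circ p k)).card

/-- The random-walk kernel of the unit circle: `A(i,j) = N_{i1}^j / (|C_i|·|C_1|)`. -/
noncomputable def kerA (p : ℕ) [NeZero p] : Matrix (ZMod p) (ZMod p) ℝ :=
  fun i j => (Ncirc p i 1 j : ℝ) / (((circ p i).card : ℝ) * ((circ p 1).card : ℝ))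

/-- The stationary distribution: `π(0) = 1/p²`, `π(j) = (p+1)/p²` for `j ≠ 0`. -/
noncomputable def piDist (p : ℕ) [NeZero p] (j : ZMod p) : ℝ :=
  if j = 0 then 1 / (p : ℝ) ^ 2 else ((p : ℝ) + 1) / (p : ℝ) ^ 2

open scoped Matrix

section helpers

variable {p : ℕ} [Fact p.Prime]

/-- The quadrance form. -/
def qf (v : ZMod p × ZMod p) : ZMod p := v.1 ^ 2 + v.2 ^ 2

/-- Gaussian multiplication on pairs. -/
def cm (z w : ZMod p × ZMod p) : ZMod p × ZMod p :=
  (z.1 * w.1 - z.2 * w.2, z.1 * w.2 + z.2 * w.1)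

lemma mem_circ_iff (K : ZMod p) (v : ZMod p × ZMod p) : v ∈ circ p K ↔ qf v = K := by
  simp [circ, qf]

lemma qf_cm (z w : ZMod p × ZMod p) : qf (cm z w) = qf z * qf w := by
  simp only [qf, cm]; ring

lemma cm_add (z v w : ZMod p × ZMod p) : cm z (v + w) = cm z v + cm z w := by
  ext <;> simp only [cm, Prod.fst_add, Prod.snd_add] <;> ring

lemma qf_eq_zero (hp : p % 4 = 3) (v : ZMod p × ZMod p) (h : qf v = 0) : v = 0 := by
  have hns : ¬ IsSquare (-1 : ZMod p) := by
    rw [ZMod.exists_sq_eq_neg_one_iff]; simpa using hp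
  simp only [qf] at h
  have h2 : v.2 = 0 := by
    by_contra h2
    apply hns
    refine ⟨v.1 / v.2, ?_⟩
    field_simp
    linear_combination -h
  have h1 : v.1 = 0 := by
    rw [h2] at h
    simpa using h
  exact Prod.ext h1 h2

lemma qf_surj (K : ZMod p) : ∃ v, qf v = K := by
  obtain ⟨a, b, h⟩ := ZMod.sq_add_sq p K
  exact ⟨(a, b), h⟩

lemma cm_inj (z : ZMod p × ZMod p) (hz : qf z ≠ 0) : Function.Injective (cm z) := by
  intro v w h
  simp only [cm, Prod.mk.injEq] at h
  obtain ⟨h1, h2⟩ := h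
  apply Prod.ext
  · apply mul_left_cancel₀ hz
    simp only [qf]
    linear_combination z.1 * h1 + z.2 * h2
  · apply mul_left_cancel₀ hz
    simp only [qf]
    linear_combination z.1 * h2 - z.2 * h1

lemma card_circ_le (K L z : ZMod p) (hz : z ≠ 0) (hL : L = z * K) :
    (circ p K).card ≤ (circ p L).card := by
  obtain ⟨g, hg⟩ := qf_surj z
  apply Finset.card_le_card_of_injOn (cm g)
  · intro v hv
    have hv' := (mem_circ_iff _ _).1 hv
    apply (mem_circ_iff _ _).2
    rw [qf_cm, hg, hv', hL]
  · exact (cm_inj g (by rwa [hg])).injOn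

lemma card_circ_eq_one (K : ZMod p) (hK : K ≠ 0) : (circ p K).card = (circ p 1).card := by
  apply le_antisymm
  · exact card_circ_le K 1 K⁻¹ (inv_ne_zero hK) (by field_simp)
  · exact card_circ_le 1 K K hK (by simp)

lemma card_circ_zero (hp : p % 4 = 3) : (circ p 0).card = 1 := by
  rw [Finset.card_eq_one]
  refine ⟨0, ?_⟩
  ext v
  rw [mem_circ_iff, Finset.mem_singleton]
  constructor
  · exact qf_eq_zero hp v
  · rintro rfl; simp [qf]

lemma card_V : (Finset.univ : Finset (ZMod p × ZMod p)).card = p ^ 2 := by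
  rw [Finset.card_univ, Fintype.card_prod, ZMod.card]; ring

lemma sum_card_circ : ∑ K : ZMod p, (circ p K).card = p ^ 2 := by
  rw [← card_V (p := p),
    Finset.card_eq_sum_card_fiberwise (f := qf) (t := Finset.univ) (by simp [Set.MapsTo])]
  rfl

lemma card_circ_unit (hp : p % 4 = 3) : (circ p 1).card = p + 1 := by
  have h := sum_card_circ (p := p)
  rw [← Finset.add_sum_erase _ _ (Finset.mem_univ (0 : ZMod p)), card_circ_zero hp,
    Finset.sum_congr rfl (fun K hK => card_circ_eq_one K (Finset.ne_of_mem_erase hK)),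
    Finset.sum_const, Finset.card_erase_of_mem (Finset.mem_univ _), Finset.card_univ,
    ZMod.card, smul_eq_mul] at h
  obtain ⟨m, rfl⟩ : ∃ m, p = m + 2 := ⟨p - 2, by omega⟩
  have e : m + 2 - 1 = m + 1 := by omega
  rw [e] at h
  have : (m + 1) * (circ (m + 2) 1).card = (m + 1) * (m + 2 + 1) := by
    nlinarith
  exact Nat.eq_of_mul_eq_mul_left (by omega) this

lemma card_circ_pos (K : ZMod p) : 0 < (circ p K).card := by
  obtain ⟨v, hv⟩ := qf_surj K
  exact Finset.card_pos.2 ⟨v, (mem_circ_iff _ _).2 hv⟩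

/-- number of unit steps from `a` to `C_j` -/
def stp (a : ZMod p × ZMod p) (j : ZMod p) : ℕ :=
  ((circ p 1).filter (fun b => qf (a + b) = j)).card

lemma stp_le (hp : p % 4 = 3) (a a' : ZMod p × ZMod p) (j : ZMod p) (h : qf a = qf a') :
    stp a j ≤ stp a' j := by
  by_cases h0 : qf a = 0
  · rw [qf_eq_zero hp a h0, qf_eq_zero hp a' (h ▸ h0)]
  obtain ⟨g, hg, hga⟩ : ∃ g, qf g = 1 ∧ cm g a = a' := by
    refine ⟨((a'.1 * a.1 + a'.2 * a.2) / qf a, (a'.2 * a.1 - a'.1 * a.2) / qf a), ?_, ?_⟩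
    · have : (a'.1 * a.1 + a'.2 * a.2) ^ 2 + (a'.2 * a.1 - a'.1 * a.2) ^ 2
          = qf a * qf a := by
        nth_rewrite 1 [h]
        simp only [qf]; ring
      rw [qf]
      simp only
      rw [div_pow, div_pow, ← add_div, this]
      field_simp
    · apply Prod.ext
      · simp only [cm]
        field_simp
        simp only [qf]; ring
      · simp only [cm]
        field_simp
        simp only [qf]; ring
  unfold stp
  apply Finset.card_le_card_of_injOn (cm g)
  · intro b hb
    simp only [Finset.coe_filter, Set.mem_ofPred_eq, mem_circ_iff] at hb ⊢
    refine ⟨by rw [qf_cm, hg, hb.1, one_mul], ?_⟩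
    rw [← hga, ← cm_add, qf_cm, hg, hb.2, one_mul]
  · exact (cm_inj g (by simp [hg])).injOn

lemma stp_eq (hp : p % 4 = 3) (a a' : ZMod p × ZMod p) (j : ZMod p) (h : qf a = qf a') :
    stp a j = stp a' j :=
  le_antisymm (stp_le hp a a' j h) (stp_le hp a' a j h.symm)

lemma Ncirc_eq_sum (i j : ZMod p) : Ncirc p i 1 j = ∑ a ∈ circ p i, stp a j := by
  unfold Ncirc stp
  simp only [Finset.card_filter, mem_circ_iff]
  rw [Finset.sum_product]

lemma kerA_eq (hp : p % 4 = 3) (a : ZMod p × ZMod p) (j : ZMod p) :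
    kerA p (qf a) j = (stp a j : ℝ) / ((p : ℝ) + 1) := by
  have h : Ncirc p (qf a) 1 j = (circ p (qf a)).card * stp a j := by
    rw [Ncirc_eq_sum, Finset.sum_congr rfl
      (fun a' ha' => stp_eq hp a' a j ((mem_circ_iff _ _).1 ha')), Finset.sum_const, smul_eq_mul]
  have hc : ((circ p (qf a)).card : ℝ) ≠ 0 := by
    exact_mod_cast (card_circ_pos (qf a)).ne'
  have h1 : ((circ p 1).card : ℝ) = p + 1 := by
    rw [card_circ_unit hp]; push_cast; ring
  unfold kerA
  rw [h, h1]
  push_cast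
  have : (p : ℝ) + 1 ≠ 0 := by positivity
  field_simp

lemma kerA_mulVec (hp : p % 4 = 3) (h : ZMod p → ℝ) (a : ZMod p × ZMod p) :
    (kerA p).mulVec h (qf a) = (∑ b ∈ circ p 1, h (qf (a + b))) / ((p : ℝ) + 1) := by
  rw [Matrix.mulVec, dotProduct,
    ← Finset.sum_fiberwise (s := circ p 1) (g := fun b => qf (a + b)), Finset.sum_div]
  apply Finset.sum_congr rfl
  intro j _
  rw [kerA_eq hp, Finset.sum_congr rfl (g := fun _ => h j)]
  · rw [Finset.sum_const, nsmul_eq_mul, stp]; ring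
  · intro b hb
    rw [(Finset.mem_filter.1 hb).2]

/-- the two-step sumset -/
def SS (p : ℕ) [Fact p.Prime] : Finset (ZMod p × ZMod p) :=
  (circ p 1 ×ˢ circ p 1).image (fun b => b.1 + b.2)

lemma fiber_le (hp : p % 4 = 3) (u : ZMod p × ZMod p) (hu : u ≠ 0) :
    ((circ p 1 ×ˢ circ p 1).filter (fun b => b.1 + b.2 = u)).card ≤ 2 := by
  have hk : qf u ≠ 0 := fun h => hu (qf_eq_zero hp u h)
  rcases Finset.eq_empty_or_nonempty
    ((circ p 1 ×ˢ circ p 1).filter (fun b => b.1 + b.2 = u)) with he | ⟨⟨b, b'⟩, hb⟩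
  · rw [he]; simp
  refine (Finset.card_le_card (t := {(b, b'), (b', b)}) ?_).trans Finset.card_le_two
  rintro ⟨d, d'⟩ hd
  simp only [Finset.mem_filter, Finset.mem_product, mem_circ_iff] at hb hd
  obtain ⟨⟨hb1, hb2⟩, rfl⟩ := hb
  obtain ⟨⟨hd1, hd2⟩, hd3⟩ := hd
  obtain ⟨b1, b2⟩ := b
  obtain ⟨c1, c2⟩ := b'
  obtain ⟨d1, d2⟩ := d
  obtain ⟨e1, e2⟩ := d'
  simp only [Prod.mk_add_mk, Prod.mk.injEq] at hd3
  obtain ⟨h1, h2⟩ := hd3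
  obtain rfl : e1 = b1 + c1 - d1 := by linear_combination h1
  obtain rfl : e2 = b2 + c2 - d2 := by linear_combination h2
  simp only [qf, Prod.mk_add_mk] at *
  have two : (2 : ZMod p) ≠ 0 := by
    intro h
    have : ((2 : ℕ) : ZMod p) = 0 := by exact_mod_cast h
    rw [ZMod.natCast_eq_zero_iff] at this
    have := Nat.le_of_dvd (by norm_num) this
    interval_cases p <;> omega
  have hdot : (b1 + c1) * (d1 - b1) + (b2 + c2) * (d2 - b2) = 0 := by
    apply mul_left_cancel₀ two
    linear_combination hd1 - hd2 - hb1 + hb2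
  -- cross products
  have hdot' : (b1 + c1) * (d1 - c1) + (b2 + c2) * (d2 - c2) = 0 := by
    linear_combination hdot + hb1 - hb2
  have hcr : ((b1 + c1) * (d2 - b2) - (b2 + c2) * (d1 - b1))
      * ((b1 + c1) * (d2 - c2) - (b2 + c2) * (d1 - c1)) = 0 := by
    have e1 : ((b1 + c1) * d1 + (b2 + c2) * d2) ^ 2 + ((b1 + c1) * d2 - (b2 + c2) * d1) ^ 2
      = (b1 + c1) ^ 2 + (b2 + c2) ^ 2 := by
      linear_combination ((b1 + c1) ^ 2 + (b2 + c2) ^ 2) * hd1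
    have e2 : ((b1 + c1) * b1 + (b2 + c2) * b2) ^ 2 + ((b1 + c1) * b2 - (b2 + c2) * b1) ^ 2
      = (b1 + c1) ^ 2 + (b2 + c2) ^ 2 := by
      linear_combination ((b1 + c1) ^ 2 + (b2 + c2) ^ 2) * hb1
    linear_combination e1 - e2 - ((b1 + c1) * (d1 + b1) + (b2 + c2) * (d2 + b2)) * hdot
  simp only [Finset.mem_insert, Finset.mem_singleton, Prod.mk.injEq]
  rcases mul_eq_zero.1 hcr with hc | hc
  · left
    have g1 : d1 - b1 = 0 := by
      apply (mul_eq_zero.1 (?_ : ((b1 + c1) ^ 2 + (b2 + c2) ^ 2) * (d1 - b1) = 0)).resolve_left hk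
      linear_combination (b1 + c1) * hdot - (b2 + c2) * hc
    have g2 : d2 - b2 = 0 := by
      apply (mul_eq_zero.1 (?_ : ((b1 + c1) ^ 2 + (b2 + c2) ^ 2) * (d2 - b2) = 0)).resolve_left hk
      linear_combination (b2 + c2) * hdot + (b1 + c1) * hc
    refine ⟨⟨?_, ?_⟩, ?_, ?_⟩
    · linear_combination g1
    · linear_combination g2
    · linear_combination -g1
    · linear_combination -g2
  · right
    have g1 : d1 - c1 = 0 := by
      apply (mul_eq_zero.1 (?_ : ((b1 + c1) ^ 2 + (b2 + c2) ^ 2) * (d1 - c1) = 0)).resolve_left hk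
      linear_combination (b1 + c1) * hdot' - (b2 + c2) * hc
    have g2 : d2 - c2 = 0 := by
      apply (mul_eq_zero.1 (?_ : ((b1 + c1) ^ 2 + (b2 + c2) ^ 2) * (d2 - c2) = 0)).resolve_left hk
      linear_combination (b2 + c2) * hdot' + (b1 + c1) * hc
    refine ⟨⟨?_, ?_⟩, ?_, ?_⟩
    · linear_combination g1
    · linear_combination g2
    · linear_combination -g1
    · linear_combination -g2

lemma fiber_zero_le :
    ((circ p 1 ×ˢ circ p 1).filter (fun b => b.1 + b.2 = 0)).card ≤ (circ p 1).card := by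
  apply Finset.card_le_card_of_injOn Prod.fst
  · intro b hb
    simp only [Finset.coe_filter, Set.mem_ofPred_eq, Finset.mem_product] at hb
    exact hb.1.1
  · intro b hb c hc h
    simp only [Finset.coe_filter, Set.mem_ofPred_eq, Finset.mem_product] at hb hc
    apply Prod.ext h
    have := hb.2.trans hc.2.symm
    rw [h] at this
    exact add_left_cancel this

lemma card_SS (hp : p % 4 = 3) : p ^ 2 + p + 2 ≤ 2 * (SS p).card := by
  have h0 : (0 : ZMod p × ZMod p) ∈ SS p := by
    obtain ⟨v, hv⟩ := qf_surj (1 : ZMod p)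
    apply Finset.mem_image.2
    refine ⟨(v, -v), ?_, by simp⟩
    simp only [Finset.mem_product, mem_circ_iff]
    exact ⟨hv, by simpa [qf] using hv⟩
  have h := Finset.card_eq_sum_card_image (fun b : (ZMod p × ZMod p) × (ZMod p × ZMod p) =>
    b.1 + b.2) (circ p 1 ×ˢ circ p 1)
  change _ = ∑ b ∈ SS p, _ at h
  rw [Finset.card_product, ← Finset.add_sum_erase _ _ h0] at h
  have hs : ∑ u ∈ (SS p).erase 0,
      ((circ p 1 ×ˢ circ p 1).filter (fun b => b.1 + b.2 = u)).card
      ≤ ((SS p).erase 0).card * 2 := by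
    rw [← smul_eq_mul]
    apply Finset.sum_le_card_nsmul
    intro u hu
    exact fiber_le hp u (Finset.ne_of_mem_erase hu)
  have hz := fiber_zero_le (p := p)
  rw [card_circ_unit hp] at h hz
  have hc := Finset.card_erase_add_one h0
  nlinarith

lemma two_step (G : ZMod p × ZMod p → ℝ) (hG : ∀ v, 0 ≤ G v) :
    ∑ u ∈ SS p, G u ≤ ∑ b ∈ circ p 1, ∑ c ∈ circ p 1, G (b + c) := by
  rw [← Finset.sum_product', SS]
  rw [← Finset.sum_fiberwise_of_maps_to (s := circ p 1 ×ˢ circ p 1)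
    (g := fun b => b.1 + b.2) (fun b hb => Finset.mem_image_of_mem _ hb)]
  apply Finset.sum_le_sum
  intro u hu
  obtain ⟨b, hb, rfl⟩ := Finset.mem_image.1 hu
  have hm : b ∈ (circ p 1 ×ˢ circ p 1).filter (fun c => c.1 + c.2 = b.1 + b.2) :=
    Finset.mem_filter.2 ⟨hb, rfl⟩
  exact Finset.single_le_sum
    (f := fun b : (ZMod p × ZMod p) × (ZMod p × ZMod p) => G (b.1 + b.2))
    (fun _ _ => hG _) hm

lemma rep_SS (hp : p % 4 = 3) (w : ZMod p × ZMod p) :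
    p + 2 ≤ ((SS p).filter (fun u => w - u ∈ SS p)).card := by
  have h1 : ((SS p).filter (fun u => w - u ∈ SS p)) = SS p ∩ (SS p).image (fun u => w - u) := by
    ext u
    simp only [Finset.mem_filter, Finset.mem_inter, Finset.mem_image, and_congr_right_iff]
    intro _
    constructor
    · intro h; exact ⟨_, h, by simp⟩
    · rintro ⟨c, hc, rfl⟩; simpa using hc
  have h2 : ((SS p).image (fun u => w - u)).card = (SS p).card :=
    Finset.card_image_of_injective _ (fun a b h => by simpa using h)
  have h3 := Finset.card_union_add_card_inter (SS p) ((SS p).image (fun u => w - u))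
  have h4 : (SS p ∪ (SS p).image (fun u => w - u)).card ≤ p ^ 2 := by
    rw [← card_V (p := p)]; exact Finset.card_le_card (Finset.subset_univ _)
  have h5 := card_SS hp
  rw [h1]
  omega

lemma four_step (hp : p % 4 = 3) (G : ZMod p × ZMod p → ℝ) (hG : ∀ v, 0 ≤ G v) :
    ((p : ℝ) + 2) * ∑ w, G w ≤
      ∑ b ∈ circ p 1, ∑ c ∈ circ p 1, ∑ d ∈ circ p 1, ∑ e ∈ circ p 1, G (b + c + d + e) := by
  have h1 : ∑ u ∈ SS p, ∑ v ∈ SS p, G (u + v) ≤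
      ∑ b ∈ circ p 1, ∑ c ∈ circ p 1, ∑ d ∈ circ p 1, ∑ e ∈ circ p 1, G (b + c + d + e) := by
    refine le_trans ?_ (two_step (fun u => ∑ d ∈ circ p 1, ∑ e ∈ circ p 1, G (u + d + e))
      (fun v => Finset.sum_nonneg fun _ _ => Finset.sum_nonneg fun _ _ => hG _))
    apply Finset.sum_le_sum
    intro u _
    have := two_step (fun v => G (u + v)) (fun v => hG _)
    simpa only [add_assoc] using this
  refine le_trans ?_ h1
  have h2 : ∀ u, ∑ v ∈ SS p, G (u + v) = ∑ w, if w - u ∈ SS p then G w else 0 := by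
    intro u
    rw [← Equiv.sum_comp (Equiv.addLeft u), ← Finset.sum_filter]
    simp
  rw [Finset.sum_congr rfl (fun u _ => h2 u), Finset.sum_comm, Finset.mul_sum]
  apply Finset.sum_le_sum
  intro w _
  rw [← Finset.sum_filter, Finset.sum_const, nsmul_eq_mul]
  apply mul_le_mul_of_nonneg_right _ (hG w)
  exact_mod_cast rep_SS hp w

lemma kerA_four (hp : p % 4 = 3) (h : ZMod p → ℝ) (a : ZMod p × ZMod p) :
    (kerA p ^ 4).mulVec h (qf a) =
      (∑ b ∈ circ p 1, ∑ c ∈ circ p 1, ∑ d ∈ circ p 1, ∑ e ∈ circ p 1,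
        h (qf (a + (b + c + d + e)))) / ((p : ℝ) + 1) ^ 4 := by
  have e4 : (kerA p ^ 4).mulVec h
      = (kerA p).mulVec ((kerA p).mulVec ((kerA p).mulVec ((kerA p).mulVec h))) := by
    simp only [Matrix.mulVec_mulVec]
    congr 1
    noncomm_ring
  rw [e4]
  simp only [kerA_mulVec hp, ← Finset.sum_div, ← add_assoc]
  rw [div_div, div_div, div_div]
  congr 1
  ring

lemma piDist_eq (hp : p % 4 = 3) (j : ZMod p) :
    piDist p j = ((circ p j).card : ℝ) / (p : ℝ) ^ 2 := by
  unfold piDist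
  split_ifs with h
  · rw [h, card_circ_zero hp]; simp
  · rw [card_circ_eq_one j h, card_circ_unit hp]; push_cast; rfl

lemma p_pos_real : (0 : ℝ) < p := by
  exact_mod_cast (Fact.out : p.Prime).pos

lemma piDist_nonneg (j : ZMod p) : 0 ≤ piDist p j := by
  unfold piDist; split_ifs <;> positivity

lemma piDist_sum (hp : p % 4 = 3) : ∑ j, piDist p j = 1 := by
  have h := sum_card_circ (p := p)
  have hpos := p_pos_real (p := p)
  simp only [piDist_eq hp, ← Finset.sum_div]
  rw [div_eq_one_iff_eq (by positivity)]
  exact_mod_cast h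

lemma minor (hp : p % 4 = 3) (i j : ZMod p) :
    (p : ℝ) ^ 2 * ((p : ℝ) - 1) / ((p : ℝ) + 1) ^ 4 * piDist p j ≤ (kerA p ^ 4) i j := by
  obtain ⟨a, rfl⟩ := qf_surj i
  have hpos := p_pos_real (p := p)
  have h1 := kerA_four hp (Pi.single j 1) a
  rw [Matrix.mulVec_single_one] at h1
  change (kerA p ^ 4) (qf a) j = _ at h1
  rw [h1, piDist_eq hp]
  have h2 := four_step hp (fun w => (Pi.single j 1 : ZMod p → ℝ) (qf (a + w)))
    (fun v => by simp only [Pi.single_apply]; split_ifs <;> norm_num)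
  have h3 : ∑ w, (Pi.single j 1 : ZMod p → ℝ) (qf (a + w)) = ((circ p j).card : ℝ) := by
    refine (Equiv.sum_comp (Equiv.addLeft a)
      (fun w => (Pi.single j 1 : ZMod p → ℝ) (qf w))).trans ?_
    simp only [Pi.single_apply, Finset.sum_boole]
    rfl
  rw [h3] at h2
  have h4 : (p : ℝ) ^ 2 * ((p : ℝ) - 1) / ((p : ℝ) + 1) ^ 4 * (((circ p j).card : ℝ) / (p : ℝ) ^ 2)
    = (((p : ℝ) - 1) * (circ p j).card) / ((p : ℝ) + 1) ^ 4 := by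
    field_simp
  rw [h4]
  apply div_le_div_of_nonneg_right _ (by positivity)
  have : (0 : ℝ) ≤ (circ p j).card := by positivity
  nlinarith

lemma rowsum (hp : p % 4 = 3) (i : ZMod p) : ∑ j, (kerA p ^ 4) i j = 1 := by
  obtain ⟨a, rfl⟩ := qf_surj i
  have hpos := p_pos_real (p := p)
  have h1 := kerA_four hp (fun _ => 1) a
  simp only [Matrix.mulVec, dotProduct, mul_one, Finset.sum_const, card_circ_unit hp,
    nsmul_eq_mul] at h1
  rw [h1, div_eq_one_iff_eq (by positivity)]
  push_cast
  ring

lemma stat1 (hp : p % 4 = 3) : (piDist p) ᵥ* (kerA p) = piDist p := by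
  funext j
  have hpos := p_pos_real (p := p)
  rw [Matrix.vecMul, dotProduct]
  have hc : ((circ p 1).card : ℝ) = p + 1 := by
    rw [card_circ_unit hp]; push_cast; ring
  have h1 : ∀ i, piDist p i * kerA p i j = (Ncirc p i 1 j : ℝ) / ((p : ℝ) ^ 2 * (p + 1)) := by
    intro i
    have : ((circ p i).card : ℝ) ≠ 0 := by exact_mod_cast (card_circ_pos i).ne'
    rw [piDist_eq hp, kerA, hc]
    field_simp
  rw [Finset.sum_congr rfl (fun i _ => h1 i), ← Finset.sum_div, piDist_eq hp]
  have h2 : ∑ i, Ncirc p i 1 j = (p + 1) * (circ p j).card := by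
    simp only [Ncirc_eq_sum]
    have : ∀ i : ZMod p, circ p i = Finset.univ.filter (fun v => qf v = i) := fun _ => rfl
    simp only [this]
    rw [Finset.sum_fiberwise]
    simp only [stp, Finset.card_filter]
    rw [Finset.sum_comm]
    have h3 : ∀ b : ZMod p × ZMod p, (∑ a, if qf (a + b) = j then 1 else 0)
        = (∑ a : ZMod p × ZMod p, if qf a = j then 1 else 0) := fun b =>
      Equiv.sum_comp (Equiv.addRight b) (fun w => if qf w = j then 1 else 0)
    rw [Finset.sum_congr rfl (fun b _ => h3 b), Finset.sum_const, card_circ_unit hp, smul_eq_mul]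
  have h2' : ∑ i, (Ncirc p i 1 j : ℝ) = ((p : ℝ) + 1) * (circ p j).card := by exact_mod_cast h2
  rw [h2']
  field_simp

lemma stat4 (hp : p % 4 = 3) : (piDist p) ᵥ* (kerA p ^ 4) = piDist p := by
  have e : kerA p ^ 4 = kerA p * kerA p * kerA p * kerA p := by noncomm_ring
  rw [e]
  simp only [← Matrix.vecMul_vecMul, stat1 hp]

end helpers

/-- Doeblin contraction. -/
lemma doeblin {ι : Type*} [Fintype ι] [DecidableEq ι] (P : Matrix ι ι ℝ) (π : ι → ℝ) (δ : ℝ)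
    (hπ0 : ∀ j, 0 ≤ π j) (hπ1 : ∑ j, π j = 1) (hrow : ∀ i, ∑ j, P i j = 1)
    (hmin : ∀ i j, δ * π j ≤ P i j) (hst : Matrix.vecMul π P = π) (n : ℕ) (i : ι) :
    ∑ j, |(P ^ n) i j - π j| ≤ 2 * (1 - δ) ^ n ∧ ∑ j, (P ^ n) i j = 1 := by
  have hδ : ∀ k, ∑ j, (P k j - δ * π j) = 1 - δ := by
    intro k
    rw [Finset.sum_sub_distrib, hrow, ← Finset.mul_sum, hπ1, mul_one]
  have hδ0 : 0 ≤ 1 - δ := by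
    rw [← hδ i]
    exact Finset.sum_nonneg fun j _ => sub_nonneg.2 (hmin i j)
  induction n with
  | zero =>
    constructor
    · calc ∑ j, |(P ^ 0) i j - π j| ≤ ∑ j, (|(1 : Matrix ι ι ℝ) i j| + π j) := by
            apply Finset.sum_le_sum
            intro j _
            rw [pow_zero]
            refine (abs_sub _ _).trans ?_
            rw [abs_of_nonneg (hπ0 j)]
        _ = 2 * (1 - δ) ^ 0 := by
            rw [Finset.sum_add_distrib, hπ1]
            simp [Matrix.one_apply, apply_ite abs]
            norm_num
    · simp [Matrix.one_apply]
  | succ n ih =>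
    obtain ⟨ih1, ih2⟩ := ih
    constructor
    · have key : ∀ j, (P ^ (n + 1)) i j - π j
          = ∑ k, ((P ^ n) i k - π k) * (P k j - δ * π j) := by
        intro j
        have hs : π j = ∑ k, π k * P k j := (congrFun hst j).symm
        have hz : ∑ k, ((P ^ n) i k - π k) * (δ * π j) = 0 := by
          rw [← Finset.sum_mul, Finset.sum_sub_distrib, ih2, hπ1]; simp
        simp only [mul_sub, Finset.sum_sub_distrib, hz]
        simp only [sub_mul, Finset.sum_sub_distrib, ← hs]
        rw [pow_succ, Matrix.mul_apply]
        ring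
      calc ∑ j, |(P ^ (n + 1)) i j - π j|
          ≤ ∑ j, ∑ k, |(P ^ n) i k - π k| * (P k j - δ * π j) := by
            apply Finset.sum_le_sum
            intro j _
            rw [key]
            refine (Finset.abs_sum_le_sum_abs _ _).trans (Finset.sum_le_sum fun k _ => ?_)
            rw [abs_mul, abs_of_nonneg (sub_nonneg.2 (hmin k j))]
        _ = (∑ k, |(P ^ n) i k - π k|) * (1 - δ) := by
            rw [Finset.sum_comm, Finset.sum_mul]
            apply Finset.sum_congr rfl
            intro k _
            rw [← Finset.mul_sum, hδ]
        _ ≤ 2 * (1 - δ) ^ n * (1 - δ) := mul_le_mul_of_nonneg_right ih1 hδ0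
        _ = 2 * (1 - δ) ^ (n + 1) := by ring
    · simp only [pow_succ, Matrix.mul_apply]
      rw [Finset.sum_comm]
      simp only [← Finset.mul_sum, hrow, mul_one, ih2]

/-- if `(1 − p²(p−1)/(p+1)⁴)ⁿ < 1/(2e)` then the total variation
distance between the walk after `4n` steps and `π` is at most `1/(2e)`. -/
theorem tv_after_four_n_steps (p : ℕ) [Fact p.Prime] (hp : p % 4 = 3) (n : ℕ)
    (hn : (1 - (p : ℝ) ^ 2 * ((p : ℝ) - 1) / ((p : ℝ) + 1) ^ 4) ^ n
        < 1 / (2 * Real.exp 1)) (i : ZMod p) :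
    (1 / 2) * ∑ j : ZMod p, |(kerA p ^ (4 * n)) i j - piDist p j|
      ≤ 1 / (2 * Real.exp 1) := by
  have h := (doeblin (kerA p ^ 4) (piDist p)
    ((p : ℝ) ^ 2 * ((p : ℝ) - 1) / ((p : ℝ) + 1) ^ 4) piDist_nonneg (piDist_sum hp)
    (rowsum hp) (minor hp) (stat4 hp) n i).1
  rw [← pow_mul] at h
  linarith
end

section
/- There exists a constant c > 0 such that for every prime p with p ≡ 3 (mod 4), every real eigenvalue α of the random-walk kernel A other than 1 (i.e., every α ∈ ℝ with α ≠ 1 for which there exists a nonzero vector v : F_p → ℝ with A·v = α·v) satisfies α ≤ 1 − c/p. -/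
open Finset

section aux

variable {p : ℕ} [Fact p.Prime]

lemma mem_circ' (K : ZMod p) (a : ZMod p × ZMod p) :
    a ∈ circ p K ↔ a.1 ^ 2 + a.2 ^ 2 = K := by
  simp [circ]

lemma aniso (hp : p % 4 = 3) (x y : ZMod p) (h : x ^ 2 + y ^ 2 = 0) : x = 0 ∧ y = 0 := by
  have hns : ¬ IsSquare (-1 : ZMod p) := by
    rw [ZMod.exists_sq_eq_neg_one_iff]; simp [hp]
  have hy : y = 0 := by
    by_contra hy
    apply hns
    refine ⟨x / y, ?_⟩
    field_simp
    linear_combination -h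
  subst hy
  refine ⟨?_, rfl⟩
  simpa using h

lemma two_ne (hp : p % 4 = 3) : (2 : ZMod p) ≠ 0 := by
  intro h
  have := aniso hp (1 : ZMod p) 1 (by linear_combination h)
  exact one_ne_zero this.1

lemma circ_lower (hp : p % 4 = 3) : p + 1 ≤ (circ p 1).card := by
  have hne : ∀ t : ZMod p, 1 + t ^ 2 ≠ 0 := by
    intro t h
    have := aniso hp 1 t (by linear_combination h)
    exact one_ne_zero this.1
  have h2 := two_ne hp
  let g : Option (ZMod p) → ZMod p × ZMod p := fun o =>
    match o with
    | none => (-1, 0)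
    | some t => ((1 - t ^ 2) / (1 + t ^ 2), 2 * t / (1 + t ^ 2))
  have hg : Function.Injective g := by
    intro s t hst
    have key : ∀ s : ZMod p, (1 - s ^ 2) / (1 + s ^ 2) ≠ -1 := by
      intro s h
      have := hne s
      field_simp at h
      apply h2
      linear_combination h
    rcases s with _ | s <;> rcases t with _ | t
    · rfl
    · exact absurd (congrArg Prod.fst hst).symm (key t)
    · exact absurd (congrArg Prod.fst hst) (key s)
    · have e1 : (1 - s ^ 2) / (1 + s ^ 2) = (1 - t ^ 2) / (1 + t ^ 2) := congrArg Prod.fst hst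
      have e2 : 2 * s / (1 + s ^ 2) = 2 * t / (1 + t ^ 2) := congrArg Prod.snd hst
      have hs := hne s
      have ht := hne t
      have k : ∀ u : ZMod p, 1 + u ^ 2 ≠ 0 →
          2 * u / (1 + u ^ 2) = u * ((1 - u ^ 2) / (1 + u ^ 2) + 1) := by
        intro u hu
        field_simp
        ring
      rw [k s hs, k t ht, ← e1] at e2
      have h0 : (1 - s ^ 2) / (1 + s ^ 2) + 1 ≠ 0 := by
        intro h
        exact key s (eq_neg_of_add_eq_zero_left h)
      rw [mul_right_cancel₀ h0 e2]
  have hc : (univ.image g).card = p + 1 := by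
    rw [card_image_of_injective _ hg]
    simp [ZMod.card]
  rw [← hc]
  apply card_le_card
  intro a ha
  rw [mem_image] at ha
  obtain ⟨o, -, rfl⟩ := ha
  rw [mem_circ']
  rcases o with _ | t
  · simp [g]
  · have := hne t
    simp only [g]
    field_simp
    ring

/-- number of ways to write d as a sum of two points of the unit circle -/
def NN (p : ℕ) [NeZero p] (d : ZMod p × ZMod p) : ℕ :=
  ((circ p 1 ×ˢ circ p 1).filter (fun ab => ab.1 + ab.2 = d)).card

lemma NN_zero : NN p 0 = (circ p 1).card := by
  unfold NN
  symm
  apply card_bij (fun a _ => (a, -a))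
  · intro a ha
    simp [mem_circ'] at ha ⊢
    exact ha
  · intro a _ b _ h
    exact congrArg Prod.fst h
  · rintro ⟨a, b⟩ h
    simp only [mem_filter, mem_product] at h
    exact ⟨a, h.1.1, by rw [eq_neg_of_add_eq_zero_right h.2]⟩

lemma NN_le (hp : p % 4 = 3) (d : ZMod p × ZMod p) (hd : d ≠ 0) : NN p d ≤ 2 := by
  by_contra hcon
  push Not at hcon
  unfold NN at hcon
  obtain ⟨a, ha, b, hb, c, hc, hab, hac, hbc⟩ := two_lt_card.1 hcon
  have h2 := two_ne hp
  have hD : d.1 ^ 2 + d.2 ^ 2 ≠ 0 := fun h => hd (Prod.ext (aniso hp _ _ h).1 (aniso hp _ _ h).2)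
  have key : ∀ u w : (ZMod p × ZMod p) × (ZMod p × ZMod p),
      u ∈ (circ p 1 ×ˢ circ p 1).filter (fun ab => ab.1 + ab.2 = d) →
      w ∈ (circ p 1 ×ˢ circ p 1).filter (fun ab => ab.1 + ab.2 = d) → u ≠ w →
      d.1 * u.1.2 - d.2 * u.1.1 = -(d.1 * w.1.2 - d.2 * w.1.1) := by
    rintro ⟨⟨u1, u2⟩, ⟨u3, u4⟩⟩ ⟨⟨w1, w2⟩, ⟨w3, w4⟩⟩ hu hw huw
    obtain ⟨d1, d2⟩ := d
    simp only [mem_filter, mem_product, mem_circ', Prod.mk_add_mk, Prod.mk.injEq] at hu hw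
    obtain ⟨⟨hu1, hu2⟩, hu3, hu4⟩ := hu
    obtain ⟨⟨hw1, hw2⟩, hw3, hw4⟩ := hw
    simp only at hD ⊢
    have eu : 2 * (u1 * d1 + u2 * d2) = d1 ^ 2 + d2 ^ 2 := by
      subst hu3; subst hu4
      linear_combination hu1 - hu2
    have ew : 2 * (w1 * d1 + w2 * d2) = d1 ^ 2 + d2 ^ 2 := by
      subst hw3; subst hw4
      linear_combination hw1 - hw2
    have e : u1 * d1 + u2 * d2 = w1 * d1 + w2 * d2 :=
      mul_left_cancel₀ h2 (eu.trans ew.symm)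
    have sq : (d1 * u2 - d2 * u1) ^ 2 = (d1 * w2 - d2 * w1) ^ 2 := by
      linear_combination (d1 ^ 2 + d2 ^ 2) * (hu1 - hw1)
        - (u1 * d1 + u2 * d2 + (w1 * d1 + w2 * d2)) * e
    rcases sq_eq_sq_iff_eq_or_eq_neg.1 sq with h | h
    · exfalso
      apply huw
      have q1 : u1 = w1 := by
        apply mul_left_cancel₀ hD
        linear_combination d1 * e - d2 * h
      have q2 : u2 = w2 := by
        apply mul_left_cancel₀ hD
        linear_combination d2 * e + d1 * h
      subst q1; subst q2
      have q3 : u3 = w3 := by linear_combination hu3 - hw3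
      have q4 : u4 = w4 := by linear_combination hu4 - hw4
      rw [q3, q4]
    · exact h
  have k1 := key a b ha hb hab
  have k2 := key a c ha hc hac
  have k3 := key b c hb hc hbc
  -- all crosses vanish
  have z : d.1 * a.1.2 - d.2 * a.1.1 = 0 := by
    apply mul_left_cancel₀ h2
    linear_combination k1 + k2 - k3
  have zb : d.1 * b.1.2 - d.2 * b.1.1 = 0 := by
    linear_combination k1 - z
  obtain ⟨⟨a1, a2⟩, ⟨a3, a4⟩⟩ := a
  obtain ⟨⟨b1, b2⟩, ⟨b3, b4⟩⟩ := b
  obtain ⟨d1, d2⟩ := d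
  simp only [mem_filter, mem_product, mem_circ', Prod.mk_add_mk, Prod.mk.injEq] at ha hb
  obtain ⟨⟨hu1, hu2⟩, hu3, hu4⟩ := ha
  obtain ⟨⟨hw1, hw2⟩, hw3, hw4⟩ := hb
  simp only at hD z zb
  have eu : 2 * (a1 * d1 + a2 * d2) = d1 ^ 2 + d2 ^ 2 := by
    subst hu3; subst hu4
    linear_combination hu1 - hu2
  have ew : 2 * (b1 * d1 + b2 * d2) = d1 ^ 2 + d2 ^ 2 := by
    subst hw3; subst hw4
    linear_combination hw1 - hw2
  have e : a1 * d1 + a2 * d2 = b1 * d1 + b2 * d2 :=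
    mul_left_cancel₀ h2 (eu.trans ew.symm)
  apply hab
  have q1 : a1 = b1 := by
    apply mul_left_cancel₀ hD
    linear_combination d1 * e - d2 * (z - zb)
  have q2 : a2 = b2 := by
    apply mul_left_cancel₀ hD
    linear_combination d2 * e + d1 * (z - zb)
  subst q1; subst q2
  have q3 : a3 = b3 := by linear_combination hu3 - hw3
  have q4 : a4 = b4 := by linear_combination hu4 - hw4
  rw [q3, q4]

lemma sum_NN (F : ZMod p × ZMod p → ℝ) :
    ∑ b ∈ circ p 1, ∑ b' ∈ circ p 1, F (b + b') = ∑ d, (NN p d : ℝ) * F d := by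
  rw [← sum_product', ← sum_fiberwise (circ p 1 ×ˢ circ p 1) (fun ab => ab.1 + ab.2)]
  apply sum_congr rfl
  intro d _
  rw [sum_congr rfl (g := fun _ => F d)]
  · rw [sum_const, nsmul_eq_mul]; rfl
  · intro x hx
    rw [(mem_filter.1 hx).2]

/-- rotation invariance -/
lemma rot (hp : p % 4 = 3) (v : ZMod p → ℝ) (a a' : ZMod p × ZMod p)
    (h : a.1 ^ 2 + a.2 ^ 2 = a'.1 ^ 2 + a'.2 ^ 2) :
    ∑ b ∈ circ p 1, v ((a + b).1 ^ 2 + (a + b).2 ^ 2)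
      = ∑ b ∈ circ p 1, v ((a' + b).1 ^ 2 + (a' + b).2 ^ 2) := by
  by_cases h0 : a.1 ^ 2 + a.2 ^ 2 = 0
  · have e1 := aniso hp _ _ h0
    have e2 := aniso hp _ _ (h ▸ h0)
    have : a = a' := Prod.ext (e1.1.trans e2.1.symm) (e1.2.trans e2.2.symm)
    rw [this]
  obtain ⟨x, y⟩ := a
  obtain ⟨z, w⟩ := a'
  simp only at h h0
  obtain ⟨r, s, hr, hs⟩ : ∃ r s : ZMod p, r * x - s * y = z ∧ r * y + s * x = w := by
    refine ⟨(z * x + w * y) / (x ^ 2 + y ^ 2), (w * x - z * y) / (x ^ 2 + y ^ 2), ?_, ?_⟩ <;>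
    · field_simp
      ring
  have hrs : r ^ 2 + s ^ 2 = 1 := by
    apply mul_right_cancel₀ h0
    rw [one_mul]
    refine Eq.trans ?_ h.symm
    rw [← hr, ← hs]
    ring
  apply sum_bij' (fun b _ => (r * b.1 - s * b.2, r * b.2 + s * b.1))
    (fun b _ => (r * b.1 + s * b.2, r * b.2 - s * b.1))
  · intro b hb
    rw [mem_circ'] at hb ⊢
    linear_combination (r ^ 2 + s ^ 2) * hb + hrs
  · intro b hb
    rw [mem_circ'] at hb ⊢
    linear_combination (r ^ 2 + s ^ 2) * hb + hrs
  · intro b hb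
    ext
    · linear_combination b.1 * hrs
    · linear_combination b.2 * hrs
  · intro b hb
    ext
    · linear_combination b.1 * hrs
    · linear_combination b.2 * hrs
  · intro b hb
    congr 1
    simp only [Prod.fst_add, Prod.snd_add]
    rw [← hr, ← hs]
    linear_combination -((x + b.1) ^ 2 + (y + b.2) ^ 2) * hrs

lemma Ncirc_sum (v : ZMod p → ℝ) (i : ZMod p) :
    ∑ j, (Ncirc p i 1 j : ℝ) * v j
      = ∑ a ∈ circ p i, ∑ b ∈ circ p 1, v ((a + b).1 ^ 2 + (a + b).2 ^ 2) := by
  rw [← sum_product', ← sum_fiberwise (circ p i ×ˢ circ p 1)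
    (fun ab => (ab.1 + ab.2).1 ^ 2 + (ab.1 + ab.2).2 ^ 2)]
  apply sum_congr rfl
  intro j _
  rw [sum_congr rfl (g := fun _ => v j)]
  · rw [sum_const, nsmul_eq_mul]
    simp only [Ncirc, mem_circ']
  · intro x hx
    rw [(mem_filter.1 hx).2]

lemma eig (hp : p % 4 = 3) (v : ZMod p → ℝ) (α : ℝ) (hv : (kerA p).mulVec v = α • v)
    (a : ZMod p × ZMod p) :
    ∑ b ∈ circ p 1, v ((a + b).1 ^ 2 + (a + b).2 ^ 2)
      = α * (circ p 1).card * v (a.1 ^ 2 + a.2 ^ 2) := by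
  set i := a.1 ^ 2 + a.2 ^ 2 with hi
  have h := congrFun hv i
  have hm : ((circ p 1).card : ℝ) ≠ 0 := by
    have := circ_lower hp
    exact_mod_cast (by omega : (circ p 1).card ≠ 0)
  have hc : ((circ p i).card : ℝ) ≠ 0 := by
    have : a ∈ circ p i := by rw [mem_circ']
    exact_mod_cast (card_pos.2 ⟨a, this⟩).ne'
  have e : (kerA p).mulVec v i
      = (∑ j, (Ncirc p i 1 j : ℝ) * v j) / (((circ p i).card : ℝ) * ((circ p 1).card : ℝ)) := by
    rw [sum_div]
    simp only [Matrix.mulVec, dotProduct, kerA]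
    apply sum_congr rfl
    intro j _
    ring
  rw [e, Ncirc_sum, sum_congr rfl (g := fun _ =>
      ∑ b ∈ circ p 1, v ((a + b).1 ^ 2 + (a + b).2 ^ 2)), sum_const, nsmul_eq_mul] at h
  · simp only [Pi.smul_apply, smul_eq_mul] at h
    field_simp at h
    linear_combination h
  · intro a' ha'
    rw [mem_circ'] at ha'
    exact rot hp v a' a (ha'.trans hi)

lemma main_aux (hp : p % 4 = 3) (α : ℝ) (hα : α ≠ 1) (v : ZMod p → ℝ) (hv0 : v ≠ 0)
    (hv : (kerA p).mulVec v = α • v) : α ≤ 1 - (1 / 2) / (p : ℝ) := by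
  set m : ℝ := ((circ p 1).card : ℝ) with hm
  have hmp : (p : ℝ) + 1 ≤ m := by
    rw [hm]; exact_mod_cast circ_lower hp
  have hp3 : (3 : ℝ) ≤ p := by
    exact_mod_cast (by omega : 3 ≤ p)
  let f : ZMod p × ZMod p → ℝ := fun a => v (a.1 ^ 2 + a.2 ^ 2)
  have hf : ∀ a, ∑ b ∈ circ p 1, f (a + b) = α * m * f a := fun a => eig hp v α hv a
  have hshift : ∀ b, ∑ a, f (a + b) = ∑ a, f a := fun b =>
    Equiv.sum_comp (Equiv.addRight b) f
  have hsum : ∑ a, f a = 0 := by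
    have h1 : ∑ a, ∑ b ∈ circ p 1, f (a + b) = α * m * ∑ a, f a := by
      rw [mul_sum]; exact sum_congr rfl fun a _ => hf a
    rw [sum_comm] at h1
    simp only [hshift, sum_const, nsmul_eq_mul] at h1
    rw [← hm] at h1
    have h2 : (1 - α) * m * ∑ a, f a = 0 := by linear_combination h1
    rcases mul_eq_zero.1 h2 with h | h
    · rcases mul_eq_zero.1 h with h | h
      · exact absurd (by linarith) hα
      · linarith
    · exact h
  obtain ⟨x, -, hx⟩ := exists_max_image univ (fun a => |f a|) univ_nonempty
  have hM : 0 < |f x| := by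
    obtain ⟨i, hi⟩ := Function.ne_iff.1 hv0
    obtain ⟨a, b, hab⟩ := ZMod.sq_add_sq p i
    refine lt_of_lt_of_le ?_ (hx (a, b) (mem_univ _))
    simp only [f, hab]
    exact abs_pos.2 hi
  have hT2 : (α * m) ^ 2 * f x = ∑ d, ((NN p d : ℝ) - 2) * f (x + d) := by
    have h1 := sum_NN (p := p) (fun d => f (x + d))
    simp only [← add_assoc, hf] at h1
    rw [← mul_sum, hf] at h1
    have h2 : ∑ d, f (x + d) = 0 := by
      rw [← hsum]; exact Equiv.sum_comp (Equiv.addLeft x) f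
    simp only [sub_mul, sum_sub_distrib, ← mul_sum, h2, ← h1]
    ring
  have hN : ∑ d, (NN p d : ℝ) = m ^ 2 := by
    have h1 := sum_NN (p := p) (fun _ => 1)
    simp only [sum_const, nsmul_eq_mul, mul_one] at h1
    rw [← h1]; ring
  have habs : ∀ d, |(NN p d : ℝ) - 2| = 2 - NN p d + (if d = 0 then 2 * (m - 2) else 0) := by
    intro d
    split_ifs with h
    · subst h
      rw [NN_zero, ← hm, abs_of_nonneg (by linarith)]; ring
    · have : (NN p d : ℝ) ≤ 2 := by exact_mod_cast NN_le hp d h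
      rw [abs_of_nonpos (by linarith)]; ring
  have hS : ∑ d, |(NN p d : ℝ) - 2| = 2 * p ^ 2 - m ^ 2 + 2 * (m - 2) := by
    simp only [habs, sum_add_distrib, sum_sub_distrib, hN, sum_ite_eq', mem_univ, if_true]
    simp [ZMod.card]
    ring
  have hle : (α * m) ^ 2 ≤ 2 * p ^ 2 - m ^ 2 + 2 * (m - 2) := by
    rw [← hS]
    apply le_of_mul_le_mul_right _ hM
    calc (α * m) ^ 2 * |f x| = |(α * m) ^ 2 * f x| := by
          rw [abs_mul, abs_of_nonneg (sq_nonneg (α * m))]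
      _ ≤ ∑ d, |((NN p d : ℝ) - 2) * f (x + d)| := by rw [hT2]; exact abs_sum_le_sum_abs _ _
      _ ≤ ∑ d, |(NN p d : ℝ) - 2| * |f x| := by
          apply sum_le_sum
          intro d _
          rw [abs_mul]
          exact mul_le_mul_of_nonneg_left (hx _ (mem_univ _)) (abs_nonneg _)
      _ = _ := by rw [sum_mul]
  have hm2 : m ≤ 2 * p := by
    by_contra hcon
    push Not at hcon
    nlinarith [sq_nonneg (α * m)]
  have h1 : (α * m) ^ 2 ≤ (m - 1) ^ 2 := by nlinarith
  have h2 : α * m ≤ m - 1 := le_trans (le_abs_self _) (abs_le_of_sq_le_sq h1 (by linarith))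
  have hmpos : 0 < m := by linarith
  have h3 : α ≤ 1 - 1 / m := by
    rw [← mul_le_mul_iff_left₀ hmpos]
    have : (1 - 1 / m) * m = m - 1 := by field_simp
    linarith
  have h4 : (1 / 2) / (p : ℝ) ≤ 1 / m := by
    rw [div_div]
    exact one_div_le_one_div_of_le hmpos hm2
  linarith

end aux

/-- every real eigenvalue of `A` other than `1` is at most `1 − c/p`
for a universal constant `c > 0`. -/
theorem second_eigenvalue_bound :
    ∃ c : ℝ, 0 < c ∧ ∀ (p : ℕ) [Fact p.Prime], p % 4 = 3 →
      ∀ α : ℝ, α ≠ 1 →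
        (∃ v : ZMod p → ℝ, v ≠ 0 ∧ (kerA p).mulVec v = α • v) →
        α ≤ 1 - c / (p : ℝ) := by
  refine ⟨1 / 2, by norm_num, ?_⟩
  intro p _ hp α hα ⟨v, hv0, hv⟩
  exact main_aux hp α hα v hv0 hv
end
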